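/- Let n ≥ 1, α > (n-1)/2 and R > 0. Then K_{R,α} is integrable on ℝⁿ and ∫_{ℝⁿ} K_{R,α}(z) dz = 1. -/

import Mathlib

open MeasureTheory Real Complex Filter
open scoped ENNReal RealInnerProductSpace

/-- Fourier transform `f̂(ξ) = ∫ e^{-2πi⟨x,ξ⟩} f(x) dx` on `ℝⁿ`. -/
noncomputable def fourierT (n : ℕ) (f : EuclideanSpace ℝ (Fin n) → ℂ)
    (ξ : EuclideanSpace ℝ (Fin n)) : ℂ :=
  ∫ x, Complex.exp (-(2 * Real.pi * ⟪x, ξ⟫ : ℝ) * Complex.I) * f x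

/-- Bochner–Riesz kernel `K_{R,α}(z) = ∫ e^{2πi⟨z,ξ⟩} (1-|ξ|²/R²)₊^α dξ`. -/
noncomputable def BRkernel (n : ℕ) (R α : ℝ) (z : EuclideanSpace ℝ (Fin n)) : ℂ :=
  ∫ ξ : EuclideanSpace ℝ (Fin n),
    Complex.exp ((2 * Real.pi * ⟪z, ξ⟫ : ℝ) * Complex.I) *
      (((max (1 - ‖ξ‖ ^ 2 / R ^ 2) 0) ^ α : ℝ) : ℂ)

/-- Bochner–Riesz operator `B_R^α[f](t) = ∫ e^{2πi⟨t,ξ⟩} (1-|ξ|²/R²)₊^α f̂(ξ) dξ`. -/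
noncomputable def BR (n : ℕ) (R α : ℝ) (f : EuclideanSpace ℝ (Fin n) → ℂ)
    (t : EuclideanSpace ℝ (Fin n)) : ℂ :=
  ∫ ξ : EuclideanSpace ℝ (Fin n),
    Complex.exp ((2 * Real.pi * ⟪t, ξ⟫ : ℝ) * Complex.I) *
      (((max (1 - ‖ξ‖ ^ 2 / R ^ 2) 0) ^ α : ℝ) : ℂ) * fourierT n f ξ

/-- The Jacobi-type weight `g(s) (1 - s²)^b` with a polynomial factor `g`. -/
noncomputable def jacobiFun (b : ℝ) (g : Polynomial ℝ) (s : ℝ) : ℝ :=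
  g.eval s * (1 - s ^ 2) ^ b

/-- The polynomial factor of the derivative of `jacobiFun b g`, whose exponent is `b - 1`. -/
noncomputable def jacobiDeriv (b : ℝ) (g : Polynomial ℝ) : Polynomial ℝ :=
  Polynomial.derivative g * (1 - Polynomial.X ^ 2) -
    Polynomial.C (2 * b) * Polynomial.X * g

/-- The Fourier integral of `jacobiFun b g` over `[-1, 1]`. -/
noncomputable def jacobiOsc (b : ℝ) (g : Polynomial ℝ) (r : ℝ) : ℂ :=
  ∫ s in (-1 : ℝ)..1, (jacobiFun b g s : ℂ) * Complex.exp ((r * s : ℝ) * Complex.I)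

lemma one_sub_sq_pos_of_mem_Ioo {s : ℝ} (hs : s ∈ Set.Ioo (-1 : ℝ) 1) : 0 < 1 - s ^ 2 := by
  nlinarith [hs.1, hs.2]

lemma hasDerivAt_jacobiFun (b : ℝ) (g : Polynomial ℝ) {s : ℝ} (hs : s ∈ Set.Ioo (-1 : ℝ) 1) :
    HasDerivAt (jacobiFun b g) (jacobiFun (b - 1) (jacobiDeriv b g) s) s := by
  have hpos := one_sub_sq_pos_of_mem_Ioo hs
  have h1 : HasDerivAt (fun s : ℝ => 1 - s ^ 2) (-(2 * s)) s := by
    simpa using (hasDerivAt_pow 2 s).const_sub 1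
  have h2 := (g.hasDerivAt s).mul (h1.rpow_const (p := b) (Or.inl hpos.ne'))
  refine h2.congr_deriv ?_
  have h3 : (1 - s ^ 2) ^ b = (1 - s ^ 2) ^ (b - 1) * (1 - s ^ 2) := by
    rw [← Real.rpow_add_one hpos.ne']; simp
  simp only [jacobiFun, jacobiDeriv, Polynomial.eval_sub, Polynomial.eval_mul, Polynomial.eval_pow,
    Polynomial.eval_X, Polynomial.eval_C, Polynomial.eval_one]
  rw [h3]; ring

lemma intervalIntegrable_one_sub_sq_rpow {b : ℝ} (hb : -1 < b) :
    IntervalIntegrable (fun s : ℝ => (1 - s ^ 2) ^ b) volume (-1) 1 := by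
  have right : IntervalIntegrable (fun s : ℝ => (1 - s ^ 2) ^ b) volume 0 1 := by
    have h1 : IntervalIntegrable (fun s : ℝ => (1 - s) ^ b) volume 0 1 := by
      simpa using ((intervalIntegral.intervalIntegrable_rpow' (a := 0) (b := 1) hb).comp_sub_left
        1).symm
    have h2 : ContinuousOn (fun s : ℝ => (1 + s) ^ b) (Set.uIcc 0 1) := by
      rw [Set.uIcc_of_le zero_le_one]
      exact ContinuousOn.rpow_const (by fun_prop)
        fun s hs => Or.inl (by linarith [hs.1] : (0 : ℝ) < 1 + s).ne'
    refine (h1.mul_continuousOn h2).congr ?_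
    rw [Set.uIoc_of_le zero_le_one]
    intro s hs
    simp only
    rw [← Real.mul_rpow (by linarith [hs.2]) (by linarith [hs.1])]
    ring_nf
  have left : IntervalIntegrable (fun s : ℝ => (1 - s ^ 2) ^ b) volume (-1) 0 := by
    simpa using (right.comp_mul_left (c := -1)).symm
  exact left.trans right

lemma intervalIntegrable_jacobiFun {b : ℝ} (hb : -1 < b) (g : Polynomial ℝ) :
    IntervalIntegrable (jacobiFun b g) volume (-1) 1 :=
  (intervalIntegrable_one_sub_sq_rpow hb).continuousOn_mul g.continuous.continuousOn

lemma norm_jacobiOsc_integrand (b : ℝ) (g : Polynomial ℝ) (r s : ℝ) :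
    ‖(jacobiFun b g s : ℂ) * Complex.exp ((r * s : ℝ) * Complex.I)‖ = |jacobiFun b g s| := by
  rw [norm_mul, Complex.norm_exp_ofReal_mul_I, mul_one, Complex.norm_real, Real.norm_eq_abs]

lemma IntervalIntegrable.complex_ofReal {f : ℝ → ℝ} {a b : ℝ}
    (hf : IntervalIntegrable f volume a b) :
    IntervalIntegrable (fun s => (f s : ℂ)) volume a b :=
  ⟨hf.1.ofReal, hf.2.ofReal⟩

lemma intervalIntegrable_jacobiOsc_integrand {b : ℝ} (hb : -1 < b) (g : Polynomial ℝ) (r : ℝ) :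
    IntervalIntegrable
      (fun s : ℝ => (jacobiFun b g s : ℂ) * Complex.exp ((r * s : ℝ) * Complex.I))
      volume (-1) 1 :=
  (intervalIntegrable_jacobiFun hb g).complex_ofReal.mul_continuousOn (by fun_prop)

/-- Integration by parts for `jacobiFun b g` against `e^{irs}` on `[-a, a] ⊆ [-1, 1]`. -/
lemma jacobi_integral_by_parts {b a r : ℝ} (g : Polynomial ℝ) (ha0 : 0 ≤ a) (ha1 : a ≤ 1)
    (hc : ContinuousOn (jacobiFun b g) (Set.Icc (-a) a))
    (hi : IntervalIntegrable (jacobiFun (b - 1) (jacobiDeriv b g)) volume (-a) a) :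
    (r : ℂ) * Complex.I * ∫ s in (-a)..a,
        (jacobiFun b g s : ℂ) * Complex.exp ((r * s : ℝ) * Complex.I) =
      (jacobiFun b g a : ℂ) * Complex.exp ((r * a : ℝ) * Complex.I) -
      (jacobiFun b g (-a) : ℂ) * Complex.exp ((r * (-a) : ℝ) * Complex.I) -
      ∫ s in (-a)..a, (jacobiFun (b - 1) (jacobiDeriv b g) s : ℂ) *
        Complex.exp ((r * s : ℝ) * Complex.I) := by
  have hab : -a ≤ a := by linarith
  have hv (s : ℝ) : HasDerivAt (fun s : ℝ => Complex.exp ((r * s : ℝ) * Complex.I))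
      (r * Complex.I * Complex.exp ((r * s : ℝ) * Complex.I)) s := by
    have h1 : HasDerivAt (fun s : ℝ => ((r * s : ℝ) : ℂ) * Complex.I) (r * Complex.I) s := by
      have := ((hasDerivAt_id s).const_mul r).ofReal_comp.mul_const Complex.I
      simpa using this
    simpa [mul_comm] using h1.cexp
  have key := intervalIntegral.integral_mul_deriv_eq_deriv_mul_of_hasDerivAt
    (a := -a) (b := a) (u := fun s => (jacobiFun b g s : ℂ))
    (v := fun s : ℝ => Complex.exp ((r * s : ℝ) * Complex.I))
    (u' := fun s => (jacobiFun (b - 1) (jacobiDeriv b g) s : ℂ))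
    (v' := fun s : ℝ => r * Complex.I * Complex.exp ((r * s : ℝ) * Complex.I))
    (by rw [Set.uIcc_of_le hab]; exact Complex.continuous_ofReal.comp_continuousOn hc)
    (by fun_prop)
    (fun s hs => by
      rw [min_eq_left hab, max_eq_right hab] at hs
      exact (hasDerivAt_jacobiFun b g ⟨by linarith [hs.1], by linarith [hs.2]⟩).ofReal_comp)
    (fun s _ => hv s) hi.complex_ofReal (Continuous.intervalIntegrable (by fun_prop) _ _)
  rw [← key, ← intervalIntegral.integral_const_mul]
  congr 1
  ext s
  ring

/-- One integration by parts lowers the exponent by one and gains a factor `r⁻¹`. -/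
lemma norm_jacobiOsc_eq {b : ℝ} (hb : 0 < b) (g : Polynomial ℝ) {r : ℝ} (hr : 0 < r) :
    ‖jacobiOsc b g r‖ = r⁻¹ * ‖jacobiOsc (b - 1) (jacobiDeriv b g) r‖ := by
  have h := jacobi_integral_by_parts (r := r) (b := b) (a := 1) g zero_le_one le_rfl
    (by
      refine g.continuous.continuousOn.mul (ContinuousOn.rpow_const (by fun_prop) ?_)
      exact fun s _ => Or.inr hb.le)
    (intervalIntegrable_jacobiFun (by linarith) _)
  have h0 : jacobiFun b g 1 = 0 := by simp [jacobiFun, hb.ne']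
  have h1 : jacobiFun b g (-1) = 0 := by simp [jacobiFun, hb.ne']
  rw [h0, h1] at h
  have h2 := congrArg norm h
  simp only [Complex.ofReal_zero, zero_mul, sub_zero, zero_sub, norm_neg, norm_mul,
    Complex.norm_real, Complex.norm_I, mul_one, Real.norm_eq_abs, abs_of_pos hr] at h2
  rw [jacobiOsc, jacobiOsc, ← h2, inv_mul_cancel_left₀ hr.ne']

lemma exists_polynomial_bound (g : Polynomial ℝ) :
    ∃ M : ℝ, 0 ≤ M ∧ ∀ s ∈ Set.Icc (-1 : ℝ) 1, |g.eval s| ≤ M := by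
  obtain ⟨M, hM⟩ := isCompact_Icc.exists_bound_of_continuousOn
    (s := Set.Icc (-1 : ℝ) 1) g.continuous.continuousOn
  exact ⟨M, (norm_nonneg _).trans (hM 0 (by simp)), hM⟩

lemma norm_integral_jacobi_right {b : ℝ} (hb : -1 < b) (hb0 : b ≤ 0) (g : Polynomial ℝ) {M : ℝ}
    (hM : ∀ s ∈ Set.Icc (-1 : ℝ) 1, |g.eval s| ≤ M) {δ : ℝ} (h0 : 0 < δ) (h1 : δ ≤ 1) (r : ℝ) :
    ‖∫ s in (1 - δ)..1, (jacobiFun b g s : ℂ) * Complex.exp ((r * s : ℝ) * Complex.I)‖ ≤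
      M / (b + 1) * δ ^ (b + 1) := by
  have hi : IntervalIntegrable (fun s : ℝ => (1 - s) ^ b) volume (1 - δ) 1 := by
    simpa using ((intervalIntegral.intervalIntegrable_rpow' (a := 0) (b := δ) hb).comp_sub_left
      1).symm
  have hval : ∫ s in (1 - δ)..1, M * (1 - s) ^ b = M / (b + 1) * δ ^ (b + 1) := by
    rw [intervalIntegral.integral_const_mul,
      intervalIntegral.integral_comp_sub_left (fun u => u ^ b) 1, integral_rpow (Or.inl hb)]
    simp [Real.zero_rpow (by linarith : b + 1 ≠ 0)]
    ring
  rw [← hval]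
  refine intervalIntegral.norm_integral_le_of_norm_le (by linarith) ?_ (hi.const_mul M)
  have hne : ∀ᵐ s : ℝ, s ≠ 1 := by simp [ae_iff]
  filter_upwards [hne] with s hs1 hs
  have hlt : s < 1 := lt_of_le_of_ne hs.2 hs1
  rw [norm_jacobiOsc_integrand, jacobiFun, abs_mul,
    abs_of_nonneg (Real.rpow_nonneg (by nlinarith [hs.1]) b)]
  have hMs := hM s ⟨by linarith [hs.1], hs.2⟩
  refine mul_le_mul hMs ?_ (Real.rpow_nonneg (by nlinarith [hs.1]) b) ((abs_nonneg _).trans hMs)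
  exact Real.rpow_le_rpow_of_nonpos (by linarith) (by nlinarith [hs.1]) hb0

lemma jacobiFun_comp_neg (b : ℝ) (g : Polynomial ℝ) (s : ℝ) :
    jacobiFun b (g.comp (-Polynomial.X)) s = jacobiFun b g (-s) := by
  simp [jacobiFun]

lemma norm_integral_jacobi_left {b : ℝ} (hb : -1 < b) (hb0 : b ≤ 0) (g : Polynomial ℝ) {M : ℝ}
    (hM : ∀ s ∈ Set.Icc (-1 : ℝ) 1, |g.eval s| ≤ M) {δ : ℝ} (h0 : 0 < δ) (h1 : δ ≤ 1) (r : ℝ) :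
    ‖∫ s in (-1)..(-(1 - δ)), (jacobiFun b g s : ℂ) * Complex.exp ((r * s : ℝ) * Complex.I)‖ ≤
      M / (b + 1) * δ ^ (b + 1) := by
  have h := norm_integral_jacobi_right hb hb0 (g.comp (-Polynomial.X)) (M := M)
    (fun s hs => by simpa using hM (-s) ⟨by linarith [hs.2], by linarith [hs.1]⟩) h0 h1 (-r)
  rw [← intervalIntegral.integral_comp_neg]
  convert h using 5 with s
  · rw [jacobiFun_comp_neg]
  · simp

lemma norm_integral_jacobi_middle {b : ℝ} (hb0 : b ≤ 0) (g : Polynomial ℝ) {M N : ℝ}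
    (hM : ∀ s ∈ Set.Icc (-1 : ℝ) 1, |g.eval s| ≤ M)
    (hN : ∀ s ∈ Set.Icc (-1 : ℝ) 1, |(jacobiDeriv b g).eval s| ≤ N)
    {δ : ℝ} (h0 : 0 < δ) (h1 : δ ≤ 1) {r : ℝ} (hr : 0 < r) :
    ‖∫ s in (-(1 - δ))..(1 - δ),
        (jacobiFun b g s : ℂ) * Complex.exp ((r * s : ℝ) * Complex.I)‖ ≤
      r⁻¹ * ((2 * M + 2 * N) * δ ^ (b - 1)) := by
  have hle : -(1 - δ) ≤ 1 - δ := by linarith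
  have hbase {s : ℝ} (hs : s ∈ Set.Icc (-(1 - δ)) (1 - δ)) : δ ≤ 1 - s ^ 2 := by
    nlinarith [hs.1, hs.2]
  have hw {c : ℝ} {q : Polynomial ℝ} :
      ContinuousOn (jacobiFun c q) (Set.Icc (-(1 - δ)) (1 - δ)) :=
    q.continuous.continuousOn.mul (ContinuousOn.rpow_const (by fun_prop)
      fun s hs => Or.inl (h0.trans_le (hbase hs)).ne')
  have hbound {c : ℝ} {q : Polynomial ℝ} {K : ℝ} (hbc : b - 1 ≤ c) (hc0 : c ≤ 0)
      (hK : ∀ s ∈ Set.Icc (-1 : ℝ) 1, |q.eval s| ≤ K) {s : ℝ}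
      (hs : s ∈ Set.Icc (-(1 - δ)) (1 - δ)) : |jacobiFun c q s| ≤ K * δ ^ (b - 1) := by
    have hKs := hK s ⟨by linarith [hs.1], by linarith [hs.2]⟩
    have hp := h0.trans_le (hbase hs)
    rw [jacobiFun, abs_mul, abs_of_nonneg (Real.rpow_nonneg hp.le c)]
    refine mul_le_mul hKs ?_ (Real.rpow_nonneg hp.le c) ((abs_nonneg _).trans hKs)
    exact (Real.rpow_le_rpow_of_nonpos h0 (hbase hs) hc0).trans
      (Real.rpow_le_rpow_of_exponent_ge h0 h1 hbc)
  have h := jacobi_integral_by_parts (r := r) (b := b) (a := 1 - δ) g (by linarith) (by linarith) hw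
    (ContinuousOn.intervalIntegrable (by rw [Set.uIcc_of_le hle]; exact hw))
  have h2 := congrArg norm h
  rw [norm_mul, norm_mul, Complex.norm_real, Complex.norm_I, mul_one, Real.norm_eq_abs,
    abs_of_pos hr] at h2
  rw [← inv_mul_cancel_left₀ hr.ne' ‖∫ s in (-(1 - δ))..(1 - δ),
        (jacobiFun b g s : ℂ) * Complex.exp ((r * s : ℝ) * Complex.I)‖, h2]
  refine mul_le_mul_of_nonneg_left ?_ (inv_nonneg.2 hr.le)
  have e1 : ‖(jacobiFun b g (1 - δ) : ℂ) * Complex.exp ((r * (1 - δ) : ℝ) * Complex.I)‖ ≤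
      M * δ ^ (b - 1) := by
    rw [norm_jacobiOsc_integrand]
    exact hbound (by linarith) hb0 hM ⟨hle, le_rfl⟩
  have e2 : ‖(jacobiFun b g (-(1 - δ)) : ℂ) * Complex.exp ((r * (-(1 - δ)) : ℝ) * Complex.I)‖ ≤
      M * δ ^ (b - 1) := by
    rw [norm_jacobiOsc_integrand]
    exact hbound (by linarith) hb0 hM ⟨le_rfl, hle⟩
  have hN0 : 0 ≤ N := (abs_nonneg _).trans (hN 0 (by simp))
  have hδ0 : 0 ≤ δ ^ (b - 1) := Real.rpow_nonneg h0.le _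
  have e3 : ‖∫ s in (-(1 - δ))..(1 - δ), (jacobiFun (b - 1) (jacobiDeriv b g) s : ℂ) *
      Complex.exp ((r * s : ℝ) * Complex.I)‖ ≤ N * δ ^ (b - 1) * 2 := by
    refine (intervalIntegral.norm_integral_le_of_norm_le_const
      (C := N * δ ^ (b - 1)) fun s hs => ?_).trans ?_
    · rw [Set.uIoc_of_le hle] at hs
      rw [norm_jacobiOsc_integrand]
      exact hbound le_rfl (by linarith) hN ⟨hs.1.le, hs.2⟩
    · refine mul_le_mul_of_nonneg_left ?_ (by positivity)
      rw [abs_of_nonneg (by linarith)]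
      linarith
  refine (norm_sub_le _ _).trans ((add_le_add ((norm_sub_le _ _).trans (add_le_add e1 e2)) e3).trans
    (le_of_eq (by ring)))

lemma exists_norm_jacobiOsc_le_of_nonpos {b : ℝ} (hb : -1 < b) (hb0 : b ≤ 0) (g : Polynomial ℝ) :
    ∃ C : ℝ, ∀ r : ℝ, 1 ≤ r → ‖jacobiOsc b g r‖ ≤ C * r ^ (-((b + 1) / 2)) := by
  obtain ⟨M, -, hM⟩ := exists_polynomial_bound g
  obtain ⟨N, -, hN⟩ := exists_polynomial_bound (jacobiDeriv b g)
  refine ⟨2 * (M / (b + 1)) + (2 * M + 2 * N), fun r hr => ?_⟩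
  have hr0 : 0 < r := by linarith
  set δ : ℝ := r ^ (-(1 / 2) : ℝ) with hδ
  have h0 : 0 < δ := Real.rpow_pos_of_pos hr0 _
  have h1 : δ ≤ 1 := Real.rpow_le_one_of_one_le_of_nonpos hr (by norm_num)
  have hint := intervalIntegrable_jacobiOsc_integrand hb g r
  have hsub {x y : ℝ} (hx : x ∈ Set.Icc (-1 : ℝ) 1) (hy : y ∈ Set.Icc (-1 : ℝ) 1) :
      IntervalIntegrable
        (fun s : ℝ => (jacobiFun b g s : ℂ) * Complex.exp ((r * s : ℝ) * Complex.I))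
        volume x y :=
    hint.mono_set (by
      rw [Set.uIcc_of_le (by norm_num : (-1 : ℝ) ≤ 1)]
      exact Set.uIcc_subset_Icc hx hy)
  have m0 : (-1 : ℝ) ∈ Set.Icc (-1 : ℝ) 1 := by simp
  have m1 : -(1 - δ) ∈ Set.Icc (-1 : ℝ) 1 := ⟨by linarith, by linarith⟩
  have m2 : 1 - δ ∈ Set.Icc (-1 : ℝ) 1 := ⟨by linarith, by linarith⟩
  have m3 : (1 : ℝ) ∈ Set.Icc (-1 : ℝ) 1 := by simp
  have hsplit : jacobiOsc b g r = _ :=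
    (intervalIntegral.integral_add_adjacent_intervals
      ((hsub m0 m1).trans (hsub m1 m2)) (hsub m2 m3)).symm
  rw [← intervalIntegral.integral_add_adjacent_intervals (hsub m0 m1) (hsub m1 m2)] at hsplit
  have p1 : δ ^ (b + 1) = r ^ (-((b + 1) / 2)) := by
    rw [hδ, ← Real.rpow_mul hr0.le]; congr 1; ring
  have p2 : r⁻¹ * δ ^ (b - 1) = r ^ (-((b + 1) / 2)) := by
    rw [hδ, ← Real.rpow_mul hr0.le, ← Real.rpow_neg_one, ← Real.rpow_add hr0]; congr 1; ring
  have e1 := norm_integral_jacobi_left hb hb0 g hM h0 h1 r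
  have e2 := norm_integral_jacobi_middle hb0 g hM hN h0 h1 hr0
  have e3 := norm_integral_jacobi_right hb hb0 g hM h0 h1 r
  rw [mul_left_comm, p2] at e2
  rw [p1] at e1 e3
  rw [hsplit]
  refine (norm_add_le _ _).trans ((add_le_add ((norm_add_le _ _).trans (add_le_add e1 e2)) e3).trans
    (le_of_eq (by ring)))

lemma exists_norm_jacobiOsc_le {b : ℝ} (hb : -1 < b) (hb0 : b ≤ 0) (k : ℕ) (g : Polynomial ℝ) :
    ∃ C : ℝ, ∀ r : ℝ, 1 ≤ r → ‖jacobiOsc (b + k) g r‖ ≤ C * r ^ (-(k + (b + 1) / 2)) := by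
  induction k generalizing g with
  | zero => simpa using exists_norm_jacobiOsc_le_of_nonpos hb hb0 g
  | succ k ih =>
    obtain ⟨C, hC⟩ := ih (jacobiDeriv (b + (k + 1 : ℕ)) g)
    refine ⟨C, fun r hr => ?_⟩
    have hr0 : 0 < r := by linarith
    have hk : (0 : ℝ) ≤ k := k.cast_nonneg
    rw [norm_jacobiOsc_eq (by push_cast; linarith) g hr0]
    have hexp : b + ((k + 1 : ℕ) : ℝ) - 1 = b + k := by push_cast; ring
    rw [hexp]
    refine (mul_le_mul_of_nonneg_left (hC r hr) (inv_nonneg.2 hr0.le)).trans (le_of_eq ?_)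
    rw [mul_left_comm, ← Real.rpow_neg_one, ← Real.rpow_add hr0]
    congr 2
    push_cast; ring

/-- If `β > n - 1`, the Fourier integral of `(1 - s²)^β` decays faster than `r⁻ⁿ`. -/
lemma exists_decay_jacobiOsc (n : ℕ) {β : ℝ} (hβ : (n : ℝ) - 1 < β) :
    ∃ γ C : ℝ, (n : ℝ) < γ ∧ ∀ r : ℝ, 1 ≤ r → ‖jacobiOsc β 1 r‖ ≤ C * r ^ (-γ) := by
  have h1 : β ≤ ⌈β⌉ := Int.le_ceil β
  have h2 : (⌈β⌉ : ℝ) < β + 1 := Int.ceil_lt_add_one β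
  have h3 : (n : ℤ) ≤ ⌈β⌉ := by
    have : (n : ℤ) - 1 < ⌈β⌉ := by exact_mod_cast (by linarith : ((n : ℝ) - 1) < ⌈β⌉)
    omega
  obtain ⟨k, hk⟩ := Int.eq_ofNat_of_zero_le ((Int.natCast_nonneg n).trans h3)
  rw [hk] at h1 h2 h3
  push_cast at h1 h2
  obtain ⟨C, hC⟩ := exists_norm_jacobiOsc_le (b := β - k) (by linarith) (by linarith) k 1
  refine ⟨k + (β - k + 1) / 2, C, ?_, fun r hr => by simpa using hC r hr⟩
  have : (n : ℝ) ≤ k := by exact_mod_cast h3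
  linarith

open scoped FourierTransform

/-- The Bochner–Riesz multiplier `(1 - |ξ|²/R²)₊^α`. -/
noncomputable def brSymbol {n : ℕ} (R α : ℝ) (ξ : EuclideanSpace ℝ (Fin n)) : ℝ :=
  (max (1 - ‖ξ‖ ^ 2 / R ^ 2) 0) ^ α

lemma continuous_brSymbol {n : ℕ} (R : ℝ) {α : ℝ} (hα : 0 ≤ α) :
    Continuous (brSymbol R α : EuclideanSpace ℝ (Fin n) → ℝ) :=
  Continuous.rpow_const (by fun_prop) fun _ => Or.inr hα

lemma hasCompactSupport_brSymbol {n : ℕ} {R α : ℝ} (hR : 0 < R) (hα : 0 < α) :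
    HasCompactSupport (brSymbol R α : EuclideanSpace ℝ (Fin n) → ℝ) := by
  refine HasCompactSupport.intro (isCompact_closedBall 0 R) fun ξ hξ => ?_
  rw [Metric.mem_closedBall, dist_zero_right, not_le] at hξ
  have : 1 ≤ ‖ξ‖ ^ 2 / R ^ 2 := by
    rw [one_le_div (by positivity)]
    gcongr
  rw [brSymbol, max_eq_right (by linarith), Real.zero_rpow hα.ne']

lemma integrable_brSymbol {n : ℕ} {R α : ℝ} (hR : 0 < R) (hα : 0 < α) :
    Integrable (fun ξ : EuclideanSpace ℝ (Fin n) => (brSymbol R α ξ : ℂ)) :=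
  ((continuous_brSymbol R hα.le).integrable_of_hasCompactSupport
    (hasCompactSupport_brSymbol hR hα)).ofReal

lemma BRkernel_eq_fourierInv (n : ℕ) (R α : ℝ) :
    BRkernel n R α = 𝓕⁻ (fun ξ : EuclideanSpace ℝ (Fin n) => (brSymbol R α ξ : ℂ)) := by
  ext z
  rw [Real.fourierInv_eq']
  simp only [BRkernel, brSymbol, smul_eq_mul, real_inner_comm]

lemma continuous_BRkernel {n : ℕ} {R α : ℝ} (hR : 0 < R) (hα : 0 < α) :
    Continuous (BRkernel n R α) := by
  rw [BRkernel_eq_fourierInv, Real.fourierInv_eq_fourier_comp_neg]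
  exact VectorFourier.fourierIntegral_continuous Real.continuous_fourierChar
    continuous_inner (integrable_brSymbol hR hα).comp_neg

lemma BRkernel_eq_of_norm_eq {n : ℕ} (R α : ℝ) {z w : EuclideanSpace ℝ (Fin n)}
    (h : ‖z‖ = ‖w‖) : BRkernel n R α z = BRkernel n R α w := by
  have hA := Submodule.reflection_sub h
  set A := (ℝ ∙ (z - w))ᗮ.reflection
  have hinv : (fun ξ : EuclideanSpace ℝ (Fin n) => (brSymbol R α ξ : ℂ)) ∘ A =
      fun ξ => (brSymbol R α ξ : ℂ) := by
    ext ξ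
    simp [brSymbol]
  rw [← hA, BRkernel_eq_fourierInv, ← Real.fourierInv_comp_linearIsometry, hinv]

lemma BRkernel_eq_scaled (n : ℕ) {R : ℝ} (α : ℝ) (hR : 0 < R) (z : EuclideanSpace ℝ (Fin n)) :
    BRkernel n R α z = (R : ℂ) ^ n * BRkernel n 1 α (R • z) := by
  have h := Measure.integral_comp_smul (volume : Measure (EuclideanSpace ℝ (Fin n)))
    (fun ξ : EuclideanSpace ℝ (Fin n) => Complex.exp ((2 * Real.pi * ⟪z, ξ⟫ : ℝ) * Complex.I) *
      (((max (1 - ‖ξ‖ ^ 2 / R ^ 2) 0) ^ α : ℝ) : ℂ)) R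
  have hL : BRkernel n 1 α (R • z) = |(R ^ n)⁻¹| • BRkernel n R α z := by
    rw [finrank_euclideanSpace_fin] at h
    refine Eq.trans ?_ h
    rw [BRkernel]
    congr 1
    ext ξ
    rw [real_inner_smul_left, real_inner_smul_right, norm_smul, mul_pow, Real.norm_eq_abs, sq_abs,
      mul_div_cancel_left₀ _ (by positivity : R ^ 2 ≠ 0), one_pow, div_one]
  rw [hL, abs_of_pos (by positivity), Complex.real_smul]
  push_cast
  rw [mul_inv_cancel_left₀ (pow_ne_zero _ (by exact_mod_cast hR.ne'))]

/-- The measurable equivalence `ℝ × ℝᵈ ≃ ℝᵈ⁺¹` of Euclidean spaces. -/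
noncomputable def euclideanConsEquiv (d : ℕ) :
    ℝ × EuclideanSpace ℝ (Fin d) ≃ᵐ EuclideanSpace ℝ (Fin (d + 1)) :=
  ((MeasurableEquiv.refl ℝ).prodCongr (MeasurableEquiv.toLp 2 (Fin d → ℝ)).symm).trans
    ((MeasurableEquiv.piFinSuccAbove (fun _ : Fin (d + 1) => ℝ) 0).symm.trans
      (MeasurableEquiv.toLp 2 (Fin (d + 1) → ℝ)))

lemma measurePreserving_euclideanConsEquiv (d : ℕ) :
    MeasurePreserving (euclideanConsEquiv d) :=
  (PiLp.volume_preserving_toLp (Fin (d + 1))).comp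
    ((volume_preserving_piFinSuccAbove (fun _ : Fin (d + 1) => ℝ) 0).symm.comp
      ((MeasurePreserving.id volume).prod (PiLp.volume_preserving_ofLp (Fin d))))

lemma euclideanConsEquiv_zero (d : ℕ) (p : ℝ × EuclideanSpace ℝ (Fin d)) :
    euclideanConsEquiv d p 0 = p.1 := by
  simp [euclideanConsEquiv, MeasurableEquiv.piFinSuccAbove, MeasurableEquiv.prodCongr]

lemma euclideanConsEquiv_succ (d : ℕ) (p : ℝ × EuclideanSpace ℝ (Fin d)) (i : Fin d) :
    euclideanConsEquiv d p i.succ = p.2 i := by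
  simp [euclideanConsEquiv, MeasurableEquiv.piFinSuccAbove, MeasurableEquiv.prodCongr]

lemma norm_sq_euclideanConsEquiv (d : ℕ) (p : ℝ × EuclideanSpace ℝ (Fin d)) :
    ‖euclideanConsEquiv d p‖ ^ 2 = p.1 ^ 2 + ‖p.2‖ ^ 2 := by
  rw [EuclideanSpace.real_norm_sq_eq, EuclideanSpace.real_norm_sq_eq, Fin.sum_univ_succ]
  simp [euclideanConsEquiv_zero, euclideanConsEquiv_succ]

lemma integral_slice_brSymbol (d : ℕ) {α : ℝ} (hα : 0 < α) (s : ℝ) :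
    ∫ y : EuclideanSpace ℝ (Fin d), (max (1 - (s ^ 2 + ‖y‖ ^ 2)) 0) ^ α =
      (max (1 - s ^ 2) 0) ^ (α + d / 2) * ∫ y : EuclideanSpace ℝ (Fin d), brSymbol 1 α y := by
  have hd : α + (d : ℝ) / 2 ≠ 0 := by positivity
  rcases le_or_gt (1 - s ^ 2) 0 with hs | hs
  · have h0 (y : EuclideanSpace ℝ (Fin d)) : (max (1 - (s ^ 2 + ‖y‖ ^ 2)) 0) ^ α = 0 := by
      rw [max_eq_right (by nlinarith [sq_nonneg ‖y‖]), Real.zero_rpow hα.ne']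
    simp [h0, max_eq_right hs, Real.zero_rpow hd]
  · set ρ := √(1 - s ^ 2) with hρ
    have hρ0 : 0 < ρ := Real.sqrt_pos.2 hs
    have hρ2 : ρ ^ 2 = 1 - s ^ 2 := Real.sq_sqrt hs.le
    have h1 (y : EuclideanSpace ℝ (Fin d)) : (max (1 - (s ^ 2 + ‖y‖ ^ 2)) 0) ^ α =
        (1 - s ^ 2) ^ α * brSymbol 1 α (ρ⁻¹ • y) := by
      rw [brSymbol, ← Real.mul_rpow hs.le (le_max_right _ _), mul_max_of_nonneg _ _ hs.le, mul_zero,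
        norm_smul, mul_pow, norm_inv, Real.norm_eq_abs, abs_of_pos hρ0, inv_pow, hρ2]
      congr 2
      field_simp
      ring
    simp_rw [h1]
    rw [integral_const_mul, Measure.integral_comp_inv_smul, finrank_euclideanSpace_fin,
      abs_of_pos (by positivity), smul_eq_mul, ← mul_assoc, max_eq_left hs.le, Real.rpow_add hs]
    congr 2
    rw [hρ, Real.sqrt_eq_rpow, ← Real.rpow_natCast, ← Real.rpow_mul hs.le]
    congr 1
    ring

/-- On a coordinate axis the kernel is a one-dimensional Fourier integral. -/
lemma BRkernel_single (d : ℕ) {α : ℝ} (hα : 0 < α) (r : ℝ) :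
    BRkernel (d + 1) 1 α (EuclideanSpace.single 0 r) =
      ((∫ y : EuclideanSpace ℝ (Fin d), brSymbol 1 α y : ℝ) : ℂ) *
        jacobiOsc (α + d / 2) 1 (2 * Real.pi * r) := by
  set c := ∫ y : EuclideanSpace ℝ (Fin d), brSymbol 1 α y with hc
  set F : EuclideanSpace ℝ (Fin (d + 1)) → ℂ := fun ξ =>
    Complex.exp ((2 * Real.pi * ⟪EuclideanSpace.single 0 r, ξ⟫ : ℝ) * Complex.I) *
      (brSymbol 1 α ξ : ℂ) with hF
  have hFi : Integrable F := by
    refine (integrable_brSymbol one_pos hα).bdd_mul (c := 1)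
      (Continuous.aestronglyMeasurable (by fun_prop)) ?_
    exact Eventually.of_forall fun ξ => (Complex.norm_exp_ofReal_mul_I _).le
  have hmp := measurePreserving_euclideanConsEquiv d
  have hval (s : ℝ) (y : EuclideanSpace ℝ (Fin d)) : F (euclideanConsEquiv d (s, y)) =
      Complex.exp ((2 * Real.pi * r * s : ℝ) * Complex.I) *
        (((max (1 - (s ^ 2 + ‖y‖ ^ 2)) 0) ^ α : ℝ) : ℂ) := by
    simp only [hF, brSymbol, norm_sq_euclideanConsEquiv, EuclideanSpace.inner_single_left,
      euclideanConsEquiv_zero, one_pow, div_one, conj_trivial, mul_assoc]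
  have hFp : Integrable (F ∘ euclideanConsEquiv d) (volume.prod volume) :=
    (hmp.integrable_comp_emb (euclideanConsEquiv d).measurableEmbedding).2 hFi
  have h1 : BRkernel (d + 1) 1 α (EuclideanSpace.single 0 r) =
      ∫ s : ℝ, ∫ y : EuclideanSpace ℝ (Fin d), F (euclideanConsEquiv d (s, y)) := by
    refine Eq.trans ?_ (integral_prod _ hFp)
    exact (hmp.integral_comp' F).symm
  have h2 (s : ℝ) : ∫ y : EuclideanSpace ℝ (Fin d), F (euclideanConsEquiv d (s, y)) =
      (c : ℂ) * (((max (1 - s ^ 2) 0) ^ (α + d / 2) : ℝ) *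
        Complex.exp ((2 * Real.pi * r * s : ℝ) * Complex.I)) := by
    simp_rw [hval]
    rw [integral_const_mul, integral_complex_ofReal, integral_slice_brSymbol d hα, ← hc]
    push_cast
    ring
  simp_rw [h1, h2]
  rw [integral_const_mul, jacobiOsc, intervalIntegral.integral_of_le (by norm_num)]
  congr 1
  have hd : α + (d : ℝ) / 2 ≠ 0 := by positivity
  rw [← setIntegral_eq_integral_of_forall_compl_eq_zero (s := Set.Ioc (-1 : ℝ) 1)]
  · refine setIntegral_congr_fun measurableSet_Ioc fun s hs => ?_
    have : 0 ≤ 1 - s ^ 2 := by nlinarith [hs.1, hs.2]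
    simp only [jacobiFun, Polynomial.eval_one, one_mul, max_eq_left this]
  · intro s hs
    have : 1 - s ^ 2 ≤ 0 := by
      by_contra! h
      have := (sq_lt_one_iff_abs_lt_one s).1 (by linarith)
      exact hs ⟨(abs_lt.1 this).1, (abs_lt.1 this).2.le⟩
    rw [max_eq_right this, Real.zero_rpow hd]
    simp

lemma norm_BRkernel_le (n : ℕ) (R α : ℝ) (z : EuclideanSpace ℝ (Fin n)) :
    ‖BRkernel n R α z‖ ≤ ∫ ξ : EuclideanSpace ℝ (Fin n), ‖(brSymbol R α ξ : ℂ)‖ := by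
  refine (norm_integral_le_integral_norm _).trans (le_of_eq ?_)
  congr 1
  ext ξ
  rw [norm_mul, Complex.norm_exp_ofReal_mul_I, one_mul, brSymbol]

lemma exists_norm_BRkernel_le (d : ℕ) {α : ℝ} (hα0 : 0 < α) (hα : (d : ℝ) / 2 < α) :
    ∃ γ C : ℝ, ((d + 1 : ℕ) : ℝ) < γ ∧ ∀ z : EuclideanSpace ℝ (Fin (d + 1)),
      ‖BRkernel (d + 1) 1 α z‖ ≤ C * (1 + ‖z‖) ^ (-γ) := by
  obtain ⟨γ, C, hγ, hC⟩ := exists_decay_jacobiOsc (d + 1) (β := α + d / 2)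
    (by push_cast; linarith)
  set c := ∫ y : EuclideanSpace ℝ (Fin d), brSymbol 1 α y
  set A := ∫ ξ : EuclideanSpace ℝ (Fin (d + 1)), ‖(brSymbol 1 α ξ : ℂ)‖
  have hA : 0 ≤ A := integral_nonneg fun _ => norm_nonneg _
  have hγ0 : 0 ≤ γ := (Nat.cast_nonneg _).trans hγ.le
  refine ⟨γ, |c| * |C| + A * 2 ^ γ, hγ, fun z => ?_⟩
  have hz0 := norm_nonneg z
  have hp : 0 ≤ (1 + ‖z‖) ^ (-γ) := by positivity
  rcases le_or_gt 1 ‖z‖ with hz | hz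
  · have hπ := Real.pi_gt_three
    have hrot : BRkernel (d + 1) 1 α z = BRkernel (d + 1) 1 α (EuclideanSpace.single 0 ‖z‖) :=
      BRkernel_eq_of_norm_eq 1 α (by simp)
    have hle : 1 + ‖z‖ ≤ 2 * Real.pi * ‖z‖ := by nlinarith
    rw [hrot, BRkernel_single d hα0, norm_mul, Complex.norm_real, Real.norm_eq_abs]
    calc |c| * ‖jacobiOsc (α + d / 2) 1 (2 * Real.pi * ‖z‖)‖
        ≤ |c| * (|C| * (1 + ‖z‖) ^ (-γ)) := by
          gcongr
          refine (hC _ (by linarith)).trans ?_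
          refine mul_le_mul (le_abs_self C) ?_ (by positivity) (abs_nonneg C)
          exact Real.rpow_le_rpow_of_nonpos (by positivity) hle (by linarith)
      _ ≤ (|c| * |C| + A * 2 ^ γ) * (1 + ‖z‖) ^ (-γ) := by
          rw [← mul_assoc]
          gcongr
          exact le_add_of_nonneg_right (by positivity)
  · have h2 : 1 ≤ 2 ^ γ * (1 + ‖z‖) ^ (-γ) := by
      rw [Real.rpow_neg (by positivity), ← div_eq_mul_inv, one_le_div (by positivity)]
      gcongr
      linarith
    calc ‖BRkernel (d + 1) 1 α z‖ ≤ A := norm_BRkernel_le _ _ _ _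
      _ ≤ A * (2 ^ γ * (1 + ‖z‖) ^ (-γ)) := le_mul_of_one_le_right hA h2
      _ ≤ (|c| * |C| + A * 2 ^ γ) * (1 + ‖z‖) ^ (-γ) := by
          rw [← mul_assoc]
          gcongr
          exact le_add_of_nonneg_left (by positivity)

lemma integrable_BRkernel_one (d : ℕ) {α : ℝ} (hα0 : 0 < α) (hα : (d : ℝ) / 2 < α) :
    Integrable (BRkernel (d + 1) 1 α) := by
  obtain ⟨γ, C, hγ, hC⟩ := exists_norm_BRkernel_le d hα0 hα
  refine Integrable.mono' ((integrable_one_add_norm (r := γ) ?_).const_mul C)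
    (continuous_BRkernel one_pos hα0).aestronglyMeasurable (Eventually.of_forall hC)
  rwa [finrank_euclideanSpace_fin]

lemma integrable_BRkernel (d : ℕ) {R α : ℝ} (hR : 0 < R) (hα0 : 0 < α) (hα : (d : ℝ) / 2 < α) :
    Integrable (BRkernel (d + 1) R α) := by
  have h := ((integrable_BRkernel_one d hα0 hα).comp_smul hR.ne').const_mul ((R : ℂ) ^ (d + 1))
  exact h.congr (Eventually.of_forall fun z => (BRkernel_eq_scaled (d + 1) α hR z).symm)

lemma integral_BRkernel {n : ℕ} {R α : ℝ} (hR : 0 < R) (hα : 0 < α)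
    (hK : Integrable (BRkernel n R α)) :
    ∫ z : EuclideanSpace ℝ (Fin n), BRkernel n R α z = 1 := by
  rw [BRkernel_eq_fourierInv] at hK ⊢
  set f : EuclideanSpace ℝ (Fin n) → ℂ := fun ξ => (brSymbol R α ξ : ℂ) with hf
  have hfourier : Integrable (𝓕 f) := by
    refine hK.comp_neg.congr (Eventually.of_forall fun z => ?_)
    simp [Real.fourierInv_eq_fourier_neg]
  have h := (integrable_brSymbol hR hα).fourier_fourierInv_eq hfourier (v := 0)
    (Complex.continuous_ofReal.comp (continuous_brSymbol R hα.le)).continuousAt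
  rw [Real.fourier_eq'] at h
  simpa [hf, brSymbol] using h

/-- for `α > (n-1)/2` the kernel `K_{R,α}` is integrable with total integral 1. -/
theorem bochnerRieszKernel_integrable_integral_one (n : ℕ) (hn : 1 ≤ n) (α R : ℝ)
    (hα : ((n : ℝ) - 1) / 2 < α) (hR : 0 < R) :
    Integrable (BRkernel n R α) volume ∧
      ∫ z : EuclideanSpace ℝ (Fin n), BRkernel n R α z = 1 := by
  obtain ⟨d, rfl⟩ := Nat.exists_eq_add_of_le' hn
  have hd : (d : ℝ) / 2 < α := by
    have h : ((d + 1 : ℕ) : ℝ) - 1 = d := by push_cast; ring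
    rwa [h] at hα
  have hα0 : 0 < α := lt_of_le_of_lt (by positivity) hd
  have hK := integrable_BRkernel d hR hα0 hd
  exact ⟨hK, integral_BRkernel hR hα0 hK⟩
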